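/- Let G be a gyrogroup. Then L(N_l(G)) = {L_a : a ∈ N_l(G)} is a normal subgroup of the left multiplication group LMlt(G). -/

import Mathlib

universe u v

/-- A gyrogroup: a groupoid `(G, +)` with a left identity `0`, left inverses `-a`,
gyroautomorphisms `gyr a b` (automorphisms of `(G, +)`) satisfying the left
gyroassociative law, and the left loop property. -/
class Gyrogroup (G : Type u) extends Add G, Zero G, Neg G where
  /-- (G1) left identity -/
  zero_add' : ∀ a : G, 0 + a = a
  /-- (G2) left inverse -/
  neg_add' : ∀ a : G, -a + a = 0
  /-- (G3) the gyroautomorphisms, as bijections of `G` -/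
  gyr : G → G → G ≃ G
  /-- (G3) each `gyr a b` preserves the operation, i.e. is an automorphism -/
  gyr_add' : ∀ a b x y : G, gyr a b (x + y) = gyr a b x + gyr a b y
  /-- (G3) left gyroassociative law -/
  add_gyr_assoc' : ∀ a b c : G, a + (b + c) = (a + b) + gyr a b c
  /-- (G4) left loop property -/
  left_loop' : ∀ a b : G, gyr (a + b) b = gyr a b

open Gyrogroup

variable {G : Type u}

/-- A subgyrogroup: a nonempty subset closed under the operation and inverses. -/
structure IsSubgyrogroup [Gyrogroup G] (H : Set G) : Prop where
  nonempty : H.Nonempty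
  add_mem : ∀ ⦃a : G⦄, a ∈ H → ∀ ⦃b : G⦄, b ∈ H → a + b ∈ H
  neg_mem : ∀ ⦃a : G⦄, a ∈ H → -a ∈ H

/-- A gyrogroup homomorphism: a map preserving the operation. -/
def IsGyroHom [Gyrogroup G] {A : Type v} [Gyrogroup A] (φ : G → A) : Prop :=
  ∀ x y : G, φ (x + y) = φ x + φ y

/-- The kernel of a map into a gyrogroup. -/
def gyroKer [Gyrogroup G] {A : Type v} [Gyrogroup A] (φ : G → A) : Set G :=
  {x : G | φ x = 0}

/-- A normal subgyrogroup: the kernel of some gyrogroup homomorphism from `G`. -/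
def IsNormalSubgyrogroup [Gyrogroup G] (N : Set G) : Prop :=
  IsSubgyrogroup N ∧ ∃ (A : Type u) (instA : Gyrogroup A) (φ : G → A),
    @IsGyroHom G _ A instA φ ∧ N = @gyroKer G _ A instA φ

/-- The gyrocommutator `[a, b] = -(a + b) + gyr a b (b + a)`. -/
def gyroCommutator [Gyrogroup G] (a b : G) : G :=
  -(a + b) + gyr a b (b + a)

/-- The set of all gyrocommutators of `G`. -/
def gyroCommutatorSet (G : Type u) [Gyrogroup G] : Set G :=
  {x : G | ∃ a b : G, x = gyroCommutator a b}

/-- `K` is the commutator subgyrogroup `G'` of `G`: the smallest subgyrogroup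
containing all commutators. -/
def IsCommutatorSubgyrogroup [Gyrogroup G] (K : Set G) : Prop :=
  IsSubgyrogroup K ∧ gyroCommutatorSet G ⊆ K ∧
    ∀ H : Set G, IsSubgyrogroup H → gyroCommutatorSet G ⊆ H → K ⊆ H

/-- `K` is the normal closure `⟨⟨A⟩⟩` of `A`: the smallest normal subgyrogroup
containing `A`. -/
def IsGyroNormalClosure [Gyrogroup G] (A K : Set G) : Prop :=
  IsNormalSubgyrogroup K ∧ A ⊆ K ∧
    ∀ N : Set G, IsNormalSubgyrogroup N → A ⊆ N → K ⊆ N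

/-- The left coset `a ⊕ H`. -/
def lcoset [Gyrogroup G] (a : G) (H : Set G) : Set G := (a + ·) '' H

/-- The right coset `H ⊕ a`. -/
def rcoset [Gyrogroup G] (H : Set G) (a : G) : Set G := (· + a) '' H

/-- A gyrogroup is gyrocommutative if `a + b = gyr a b (b + a)` for all `a, b`. -/
def IsGyrocommutative (G : Type u) [Gyrogroup G] : Prop :=
  ∀ a b : G, a + b = gyr a b (b + a)

/-- An L-subgyrogroup: a subgyrogroup with `gyr a h (H) = H` for all `a ∈ G`, `h ∈ H`. -/
def IsLSubgyrogroup [Gyrogroup G] (H : Set G) : Prop :=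
  IsSubgyrogroup H ∧ ∀ a : G, ∀ h ∈ H, ⇑(gyr a h) '' H = H

/-- A subgroup of a gyrogroup: a subgyrogroup that forms a group under the gyrogroup
operation (equivalently, on which the operation is associative; together with the
closure properties and the identity and inverses inherited from `G`, this makes it
a group). -/
def IsSubgroupOfGyrogroup [Gyrogroup G] (H : Set G) : Prop :=
  IsSubgyrogroup H ∧ ∀ a ∈ H, ∀ b ∈ H, ∀ c ∈ H, a + (b + c) = (a + b) + c

/-- The left nucleus of `G`. -/
def leftNucleus (G : Type u) [Gyrogroup G] : Set G :=
  {a : G | ∀ b c : G, a + (b + c) = (a + b) + c}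

/-- The middle nucleus of `G`. -/
def middleNucleus (G : Type u) [Gyrogroup G] : Set G :=
  {b : G | ∀ a c : G, a + (b + c) = (a + b) + c}

/-- The right nucleus of `G`. -/
def rightNucleus (G : Type u) [Gyrogroup G] : Set G :=
  {c : G | ∀ a b : G, a + (b + c) = (a + b) + c}

/-- `L(G)`: the set of left gyrotranslations of `G`, viewed as permutations of `G`.
A permutation `σ` is a left gyrotranslation when `σ x = a + x` for some fixed `a`. -/
def LSet (G : Type u) [Gyrogroup G] : Set (Equiv.Perm G) :=
  {σ : Equiv.Perm G | ∃ a : G, ∀ x : G, σ x = a + x}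

/-- `L(H)` for a subset `H ⊆ G`: the left gyrotranslations by elements of `H`. -/
def LSetOf [Gyrogroup G] (H : Set G) : Set (Equiv.Perm G) :=
  {σ : Equiv.Perm G | ∃ a ∈ H, ∀ x : G, σ x = a + x}

/-- The left multiplication group `LMlt(G)`: the subgroup of `Sym(G)` generated by
the left gyrotranslations. -/
def LMlt (G : Type u) [Gyrogroup G] : Subgroup (Equiv.Perm G) :=
  Subgroup.closure (LSet G)

/-- `L(G)'`: the set of products `L_{a₁} ∘ ⋯ ∘ L_{aₙ}` of left gyrotranslations whose
reversed product `L_{aₙ} ∘ ⋯ ∘ L_{a₁}` is the identity. -/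
def LPrime (G : Type u) [Gyrogroup G] : Set (Equiv.Perm G) :=
  {σ : Equiv.Perm G | ∃ l : List (Equiv.Perm G),
    (∀ τ ∈ l, τ ∈ LSet G) ∧ σ = l.prod ∧ l.reverse.prod = 1}

/-- `L(G)^# = ⋂_{a ∈ G} L_a ∘ L(G)`. -/
def LSharp (G : Type u) [Gyrogroup G] : Set (Equiv.Perm G) :=
  {σ : Equiv.Perm G | ∀ ρ ∈ LSet G, ∃ τ ∈ LSet G, σ = ρ * τ}

/-- The radical of `G`: elements whose left gyrotranslation lies in `L(G)'`. -/
def gyroRadical (G : Type u) [Gyrogroup G] : Set G :=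
  {a : G | ∃ σ ∈ LPrime G, ∀ x : G, σ x = a + x}

/-- `X` is a normal subgroup of the subgroup `Γ` (as a subset of the ambient group). -/
def IsNormalSubgroupIn {M : Type v} [Group M] (Γ : Subgroup M) (X : Set M) : Prop :=
  X ⊆ (Γ : Set M) ∧ (1 : M) ∈ X ∧ (∀ σ ∈ X, σ⁻¹ ∈ X) ∧
    (∀ σ ∈ X, ∀ τ ∈ X, σ * τ ∈ X) ∧ ∀ γ ∈ Γ, ∀ σ ∈ X, γ * σ * γ⁻¹ ∈ X

/-- The coaddition `a ⊞ b = a + gyr a (-b) b`. -/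
def gyroCoadd [Gyrogroup G] (a b : G) : G := a + gyr a (-b) b

/-- Natural-number multiples: `0 • a = 0`, `(m+1) • a = a + m • a`. -/
def gyroNsmul [Gyrogroup G] : ℕ → G → G
  | 0, _ => 0
  | n + 1, a => a + gyroNsmul n a

/-- The index `[G : H]`: the number of left cosets of `H` in `G`. -/
noncomputable def gyroIndex [Gyrogroup G] (H : Set G) : ℕ :=
  Set.ncard {S : Set G | ∃ a : G, S = lcoset a H}

namespace Gyrogroup

variable [Gyrogroup G]

theorem add_left_cancel' {a b c : G} (h : a + b = a + c) : b = c := by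
  have h' : -a + (a + b) = -a + (a + c) := by rw [h]
  rw [add_gyr_assoc', add_gyr_assoc', neg_add', zero_add', zero_add'] at h'
  exact (gyr (-a) a).injective h'

theorem gyr_zero_left (a x : G) : gyr 0 a x = x := by
  have h := add_gyr_assoc' 0 a x
  rw [zero_add', zero_add'] at h
  exact (add_left_cancel' h).symm

theorem neg_add_cancel_left' (a b : G) : -a + (a + b) = b := by
  rw [add_gyr_assoc', ← left_loop', neg_add', gyr_zero_left, zero_add']

theorem add_zero' (a : G) : a + 0 = a := by
  apply add_left_cancel' (a := -a)
  rw [neg_add_cancel_left', neg_add']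

theorem neg_neg' (a : G) : - -a = a := by
  rw [← add_zero' (- -a), ← neg_add' a, neg_add_cancel_left']

theorem add_neg_cancel_left' (a b : G) : a + (-a + b) = b := by
  simpa only [neg_neg'] using neg_add_cancel_left' (-a) b

theorem add_neg' (a : G) : a + -a = 0 := by
  simpa only [neg_neg'] using neg_add' (-a)

/-- The left Bol identity. -/
theorem add_add_add_bol (u v x : G) : u + (v + (u + x)) = (u + (v + u)) + x := by
  have h₁ := add_gyr_assoc' (-v) (v + u) (-(v + u) + (v + (u + x)))
  have h₂ := add_gyr_assoc' u (v + u) (-(v + u) + (v + (u + x)))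
  have h₃ := left_loop' (-v) (v + u)
  rw [neg_add_cancel_left'] at h₃
  rw [add_neg_cancel_left', neg_add_cancel_left', neg_add_cancel_left'] at h₁
  rw [add_neg_cancel_left', h₃, ← add_left_cancel' h₁] at h₂
  exact h₂

theorem gyr_gyr_swap (a b x : G) : gyr b a (gyr a b x) = x := by
  have h : b + (a + (-(a + b) + (a + (b + x)))) = (b + a) + x := by
    rw [add_add_add_bol a, add_add_add_bol b, ← add_add_add_bol a, neg_add', add_zero']
  rw [add_gyr_assoc' a b x, neg_add_cancel_left', add_gyr_assoc' b a] at h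
  exact add_left_cancel' h

theorem gyr_add_left_of_mem_leftNucleus {n : G} (hn : n ∈ leftNucleus G) (d a x : G) :
    gyr (n + d) a x = gyr d a x := by
  have h := add_gyr_assoc' (n + d) a x
  rw [← hn d (a + x), add_gyr_assoc' d a x, hn (d + a), hn d a] at h
  exact (add_left_cancel' h).symm

theorem gyr_add_right_of_mem_leftNucleus {n : G} (hn : n ∈ leftNucleus G) (a d x : G) :
    gyr a (n + d) x = gyr a d x := by
  apply (gyr d a).injective
  rw [gyr_gyr_swap, ← gyr_add_left_of_mem_leftNucleus hn, gyr_gyr_swap]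

theorem conj_apply_eq_add {n : G} (hn : n ∈ leftNucleus G) (b x : G) :
    b + (n + (-b + x)) = (b + (n + -b)) + x := by
  have h := add_gyr_assoc' b (-b) x
  rw [add_neg_cancel_left', add_neg', zero_add'] at h
  rw [hn, add_gyr_assoc', gyr_add_right_of_mem_leftNucleus hn, ← h]

theorem conj_mem_leftNucleus {n : G} (hn : n ∈ leftNucleus G) (b : G) :
    b + (n + -b) ∈ leftNucleus G := by
  intro c x
  have h := add_gyr_assoc' b (-b + c) (gyr (-b) c x)
  rw [← add_gyr_assoc' (-b) c x, add_neg_cancel_left', add_neg_cancel_left'] at h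
  rw [← conj_apply_eq_add hn, ← conj_apply_eq_add hn, add_gyr_assoc' (-b) c x,
    hn (-b + c), add_gyr_assoc' b, gyr_add_right_of_mem_leftNucleus hn,
    ← add_left_cancel' h]

theorem zero_mem_leftNucleus : (0 : G) ∈ leftNucleus G := fun b c => by
  rw [zero_add', zero_add']

theorem add_mem_leftNucleus {m n : G} (hm : m ∈ leftNucleus G) (hn : n ∈ leftNucleus G) :
    m + n ∈ leftNucleus G := fun b c => by
  rw [← hm n (b + c), hn b c, hm (n + b) c, hm n b]

theorem neg_mem_leftNucleus {n : G} (hn : n ∈ leftNucleus G) : -n ∈ leftNucleus G :=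
  fun b c => by
    apply add_left_cancel' (a := n)
    rw [add_neg_cancel_left', hn (-n + b) c, add_neg_cancel_left']

theorem inv_apply_of_apply_eq_add {σ : Equiv.Perm G} {a : G} (h : ∀ x, σ x = a + x) (x : G) :
    σ⁻¹ x = -a + x := by
  rw [Equiv.Perm.inv_eq_iff_eq, h, add_neg_cancel_left']

theorem conj_mem_LSetOf_leftNucleus {γ σ : Equiv.Perm G} (hγ : γ ∈ LSet G)
    (hσ : σ ∈ LSetOf (leftNucleus G)) : γ * σ * γ⁻¹ ∈ LSetOf (leftNucleus G) := by
  obtain ⟨b, hb⟩ := hγ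
  obtain ⟨n, hn, h⟩ := hσ
  refine ⟨_, conj_mem_leftNucleus hn b, fun x => ?_⟩
  rw [Equiv.Perm.mul_apply, Equiv.Perm.mul_apply, inv_apply_of_apply_eq_add hb, h, hb,
    conj_apply_eq_add hn]

theorem inv_mem_LSet {γ : Equiv.Perm G} (hγ : γ ∈ LSet G) : γ⁻¹ ∈ LSet G := by
  obtain ⟨b, hb⟩ := hγ
  exact ⟨-b, inv_apply_of_apply_eq_add hb⟩

end Gyrogroup

/-- `L(N_l(G))` is a normal subgroup of the left multiplication
group `LMlt(G)`. -/
theorem LSet_leftNucleus_normal_in_LMlt (G : Type u) [Gyrogroup G] :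
    IsNormalSubgroupIn (LMlt G) (LSetOf (leftNucleus G)) := by
  refine ⟨?_, ⟨0, zero_mem_leftNucleus, fun x => (zero_add' x).symm⟩, ?_, ?_, ?_⟩
  · rintro σ ⟨a, -, h⟩
    exact Subgroup.subset_closure ⟨a, h⟩
  · rintro σ ⟨n, hn, h⟩
    exact ⟨-n, neg_mem_leftNucleus hn, inv_apply_of_apply_eq_add h⟩
  · rintro σ ⟨m, hm, h⟩ τ ⟨n, hn, h'⟩
    refine ⟨m + n, add_mem_leftNucleus hm hn, fun x => ?_⟩
    rw [Equiv.Perm.mul_apply, h', h, hm]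
  · intro γ hγ
    induction hγ using Subgroup.closure_induction'' with
    | mem γ hγ => exact fun σ => conj_mem_LSetOf_leftNucleus hγ
    | inv_mem γ hγ => exact fun σ => conj_mem_LSetOf_leftNucleus (inv_mem_LSet hγ)
    | one => simp
    | mul γ δ _ _ ihγ ihδ =>
      intro σ hσ
      simpa only [mul_inv_rev, mul_assoc] using ihγ _ (ihδ σ hσ)
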